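/- Fix N ≥ 1 and indices 0 ≤ i < j < N, and define the Jordan–Wigner Majorana operators c_{2k} = a_k + a_k†, c_{2k+1} = −i(a_k − a_k†) on N qubits. Let a, b, c, d, e, f be real numbers and let M be the 4 × 4 real skew-symmetric matrix with first row (0, e, a, b), second row (−e, 0, c, d), third row (−a, −c, 0, f), fourth row (−b, −d, −f, 0). Then (i/4) · Σ_{p,q=1}^{4} M(p,q) · (v_p v_q), where (v_1, v_2, v_3, v_4) = (c_{2i}, c_{2i+1}, c_{2j}, c_{2j+1}), equals −(e/2) · Z_i − (f/2) · Z_j − (c/2) · X_i Z⋯Z X_j + (b/2) · Y_i Z⋯Z Y_j − (d/2) · X_i Z⋯Z Y_j + (a/2) · Y_i Z⋯Z X_j. -/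

import Mathlib

open Matrix

/-- Tensor product of `N` single-qubit matrices, as a matrix indexed by bit strings. -/
noncomputable def tensorProd {N : ℕ} (M : Fin N → Matrix (Fin 2) (Fin 2) ℂ) :
    Matrix (Fin N → Fin 2) (Fin N → Fin 2) ℂ :=
  Matrix.of fun s t => ∏ k, M k (s k) (t k)

/-- Pauli `X`. -/
def pauliX : Matrix (Fin 2) (Fin 2) ℂ := !![0, 1; 1, 0]

/-- Pauli `Y`. -/
def pauliY : Matrix (Fin 2) (Fin 2) ℂ := !![0, -Complex.I; Complex.I, 0]

/-- Pauli `Z`. -/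
def pauliZ : Matrix (Fin 2) (Fin 2) ℂ := !![1, 0; 0, -1]

/-- Jordan–Wigner annihilation operator `a_j` on `N` qubits: `Z` on slots before `j`,
`(X + iY)/2` on slot `j`, identity after. -/
noncomputable def aOp (N : ℕ) (j : Fin N) : Matrix (Fin N → Fin 2) (Fin N → Fin 2) ℂ :=
  tensorProd fun k =>
    if k < j then pauliZ
    else if k = j then (2 : ℂ)⁻¹ • (pauliX + Complex.I • pauliY)
    else 1

/-- `P_j`: single-qubit matrix `P` in slot `j`, identity elsewhere. -/
noncomputable def singleSite (N : ℕ) (j : Fin N) (P : Matrix (Fin 2) (Fin 2) ℂ) :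
    Matrix (Fin N → Fin 2) (Fin N → Fin 2) ℂ :=
  tensorProd fun k => if k = j then P else 1

/-- `P_i Z⋯Z Q_j`: `P` in slot `i`, Pauli `Z` strictly between `i` and `j`, `Q` in
slot `j`, identity elsewhere. -/
noncomputable def pauliString (N : ℕ) (i j : Fin N) (P Q : Matrix (Fin 2) (Fin 2) ℂ) :
    Matrix (Fin N → Fin 2) (Fin N → Fin 2) ℂ :=
  tensorProd fun k =>
    if k = i then P else if k = j then Q else if i < k ∧ k < j then pauliZ else 1

theorem tensorProd_mul' {N : ℕ} (A B : Fin N → Matrix (Fin 2) (Fin 2) ℂ) :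
    tensorProd A * tensorProd B = tensorProd fun k => A k * B k := by
  ext s t
  simp only [tensorProd, Matrix.mul_apply, Matrix.of_apply]
  rw [Finset.prod_univ_sum, Fintype.piFinset_univ]
  exact Finset.sum_congr rfl fun x _ => Finset.prod_mul_distrib.symm

theorem tensorProd_conjT {N : ℕ} (A : Fin N → Matrix (Fin 2) (Fin 2) ℂ) :
    (tensorProd A)ᴴ = tensorProd fun k => (A k)ᴴ := by
  ext s t
  simp [tensorProd, Matrix.conjTranspose_apply]

theorem tensorProd_lin {N : ℕ} (j : Fin N) (A B C : Fin N → Matrix (Fin 2) (Fin 2) ℂ) (x y : ℂ)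
    (hA : ∀ k, k ≠ j → A k = C k) (hB : ∀ k, k ≠ j → B k = C k)
    (hC : C j = x • A j + y • B j) :
    tensorProd C = x • tensorProd A + y • tensorProd B := by
  ext s t
  simp only [tensorProd, Matrix.of_apply, Matrix.add_apply, Matrix.smul_apply, smul_eq_mul]
  rw [← Finset.mul_prod_erase _ _ (Finset.mem_univ j),
    ← Finset.mul_prod_erase _ (fun k => A k (s k) (t k)) (Finset.mem_univ j),
    ← Finset.mul_prod_erase _ (fun k => B k (s k) (t k)) (Finset.mem_univ j)]
  rw [Finset.prod_congr rfl (fun k hk => by rw [hA k (Finset.ne_of_mem_erase hk)] :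
      ∀ k ∈ Finset.univ.erase j, A k (s k) (t k) = C k (s k) (t k)),
    Finset.prod_congr rfl (fun k hk => by rw [hB k (Finset.ne_of_mem_erase hk)] :
      ∀ k ∈ Finset.univ.erase j, B k (s k) (t k) = C k (s k) (t k)), hC]
  simp only [Matrix.add_apply, Matrix.smul_apply, smul_eq_mul]
  ring

/-- The string with `Z` before slot `j`, `P` in slot `j`. -/
noncomputable def jwStr (N : ℕ) (j : Fin N) (P : Matrix (Fin 2) (Fin 2) ℂ) :
    Matrix (Fin N → Fin 2) (Fin N → Fin 2) ℂ :=
  tensorProd fun k => if k < j then pauliZ else if k = j then P else 1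

theorem jwStr_lin (N : ℕ) (j : Fin N) (P Q : Matrix (Fin 2) (Fin 2) ℂ) (x y : ℂ) :
    jwStr N j (x • P + y • Q) = x • jwStr N j P + y • jwStr N j Q := by
  apply tensorProd_lin j
  · intro k hk; simp [hk]
  · intro k hk; simp [hk]
  · simp

theorem singleSite_smul (N : ℕ) (j : Fin N) (P : Matrix (Fin 2) (Fin 2) ℂ) (x : ℂ) :
    singleSite N j (x • P) = x • singleSite N j P := by
  have := tensorProd_lin j (fun k => if k = j then P else 1) (fun k => if k = j then P else 1)
    (fun k => if k = j then x • P else 1) x 0 (by intro k hk; simp [hk])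
    (by intro k hk; simp [hk]) (by simp)
  simpa [singleSite] using this

theorem pauliString_smul (N : ℕ) (i j : Fin N) (P Q : Matrix (Fin 2) (Fin 2) ℂ) (x : ℂ) :
    pauliString N i j (x • P) Q = x • pauliString N i j P Q := by
  have := tensorProd_lin i
    (fun k => if k = i then P else if k = j then Q else if i < k ∧ k < j then pauliZ else 1)
    (fun k => if k = i then P else if k = j then Q else if i < k ∧ k < j then pauliZ else 1)
    (fun k => if k = i then x • P else if k = j then Q else if i < k ∧ k < j then pauliZ else 1)
    x 0 (by intro k hk; simp [hk])
    (by intro k hk; simp [hk]) (by simp)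
  simpa [pauliString] using this

theorem pauliZ_sq : pauliZ * pauliZ = 1 := by
  ext a b; fin_cases a <;> fin_cases b <;> simp [pauliZ]

theorem pauliZ_conjT : pauliZᴴ = pauliZ := by
  ext a b; fin_cases a <;> fin_cases b <;> simp [pauliZ]

theorem jwStr_conjT (N : ℕ) (j : Fin N) (P : Matrix (Fin 2) (Fin 2) ℂ) :
    (jwStr N j P)ᴴ = jwStr N j Pᴴ := by
  rw [jwStr, tensorProd_conjT, jwStr]
  congr 1; funext k
  split_ifs <;> simp [pauliZ_conjT]

theorem jwStr_mul_self (N : ℕ) (j : Fin N) (P Q : Matrix (Fin 2) (Fin 2) ℂ) :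
    jwStr N j P * jwStr N j Q = singleSite N j (P * Q) := by
  rw [jwStr, jwStr, tensorProd_mul', singleSite]
  congr 1; funext k
  rcases lt_trichotomy k j with h | h | h
  · simp [h, h.ne, pauliZ_sq]
  · simp [h]
  · simp [h.not_gt, h.ne']

theorem jwStr_mul_lt (N : ℕ) (i j : Fin N) (hij : i < j) (P Q : Matrix (Fin 2) (Fin 2) ℂ) :
    jwStr N i P * jwStr N j Q = pauliString N i j (P * pauliZ) Q := by
  rw [jwStr, jwStr, tensorProd_mul', pauliString]
  congr 1; funext k
  rcases lt_trichotomy k i with h | h | h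
  · simp [h, h.ne, h.trans hij, (h.trans hij).ne, h.not_gt, pauliZ_sq]
  · subst h; simp [hij]
  · rcases lt_trichotomy k j with h' | h' | h'
    · simp [h.not_gt, h.ne', h', h, h'.ne]
    · subst h'; simp [h.not_gt, h.ne']
    · simp [h.not_gt, h.ne', h'.not_gt, h'.ne']

theorem jwStr_mul_gt (N : ℕ) (i j : Fin N) (hij : i < j) (P Q : Matrix (Fin 2) (Fin 2) ℂ) :
    jwStr N j Q * jwStr N i P = pauliString N i j (pauliZ * P) Q := by
  rw [jwStr, jwStr, tensorProd_mul', pauliString]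
  congr 1; funext k
  rcases lt_trichotomy k i with h | h | h
  · simp [h, h.ne, h.trans hij, (h.trans hij).ne, h.not_gt, pauliZ_sq]
  · subst h; simp [hij]
  · rcases lt_trichotomy k j with h' | h' | h'
    · simp [h.not_gt, h.ne', h', h, h'.ne]
    · subst h'; simp [h.not_gt, h.ne']
    · simp [h.not_gt, h.ne', h'.not_gt, h'.ne']

theorem majorana_even (N : ℕ) (j : Fin N) : aOp N j + (aOp N j)ᴴ = jwStr N j pauliX := by
  change jwStr N j _ + (jwStr N j _)ᴴ = _
  rw [jwStr_conjT]
  have := jwStr_lin N j ((2 : ℂ)⁻¹ • (pauliX + Complex.I • pauliY))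
    ((2 : ℂ)⁻¹ • (pauliX + Complex.I • pauliY))ᴴ 1 1
  simp only [one_smul] at this
  rw [← this]
  congr 1
  ext a b; fin_cases a <;> fin_cases b <;> simp [pauliX, pauliY] <;> norm_num

theorem majorana_odd (N : ℕ) (j : Fin N) :
    (-Complex.I) • (aOp N j - (aOp N j)ᴴ) = jwStr N j pauliY := by
  change (-Complex.I) • (jwStr N j _ - (jwStr N j _)ᴴ) = _
  rw [jwStr_conjT]
  have := jwStr_lin N j ((2 : ℂ)⁻¹ • (pauliX + Complex.I • pauliY))
    ((2 : ℂ)⁻¹ • (pauliX + Complex.I • pauliY))ᴴ (-Complex.I) Complex.I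
  rw [smul_sub, sub_eq_add_neg, neg_smul _ (jwStr N j (_ᴴ)), neg_neg, ← this]
  congr 1
  ext a b; fin_cases a <;> fin_cases b <;> simp [pauliX, pauliY] <;> ring

theorem pXY : pauliX * pauliY = Complex.I • pauliZ := by
  ext a b; fin_cases a <;> fin_cases b <;> simp [pauliX, pauliY, pauliZ]
theorem pYX : pauliY * pauliX = (-Complex.I) • pauliZ := by
  ext a b; fin_cases a <;> fin_cases b <;> simp [pauliX, pauliY, pauliZ]
theorem pXZ : pauliX * pauliZ = (-Complex.I) • pauliY := by
  ext a b; fin_cases a <;> fin_cases b <;> simp [pauliX, pauliY, pauliZ]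
theorem pZX : pauliZ * pauliX = Complex.I • pauliY := by
  ext a b; fin_cases a <;> fin_cases b <;> simp [pauliX, pauliY, pauliZ]
theorem pYZ : pauliY * pauliZ = Complex.I • pauliX := by
  ext a b; fin_cases a <;> fin_cases b <;> simp [pauliX, pauliY, pauliZ]
theorem pZY : pauliZ * pauliY = (-Complex.I) • pauliX := by
  ext a b; fin_cases a <;> fin_cases b <;> simp [pauliX, pauliY, pauliZ]

/-- The general two-mode quadratic Majorana Hamiltonian
`(i/4) Σ_{p,q} M(p,q) v_p v_q` with `(v_1,…,v_4) = (c_{2i}, c_{2i+1}, c_{2j}, c_{2j+1})`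
and `M` the skew-symmetric matrix built from `a,…,f` equals the sum of Pauli strings
`−(e/2) Z_i − (f/2) Z_j − (c/2) X_i Z⋯Z X_j + (b/2) Y_i Z⋯Z Y_j
 − (d/2) X_i Z⋯Z Y_j + (a/2) Y_i Z⋯Z X_j`. -/
theorem two_mode_quadratic_majorana_pauli_form
    (N : ℕ) (hN : 1 ≤ N) (i j : Fin N) (hij : i < j) (a b c d e f : ℝ) :
    let v : Fin 4 → Matrix (Fin N → Fin 2) (Fin N → Fin 2) ℂ :=
      ![aOp N i + (aOp N i)ᴴ,
        (-Complex.I) • (aOp N i - (aOp N i)ᴴ),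
        aOp N j + (aOp N j)ᴴ,
        (-Complex.I) • (aOp N j - (aOp N j)ᴴ)]
    let M : Matrix (Fin 4) (Fin 4) ℝ :=
      !![0, e, a, b; -e, 0, c, d; -a, -c, 0, f; -b, -d, -f, 0]
    (Complex.I / 4) • ∑ p : Fin 4, ∑ q : Fin 4, (M p q : ℂ) • (v p * v q)
      = (-(e : ℂ) / 2) • singleSite N i pauliZ + (-(f : ℂ) / 2) • singleSite N j pauliZ
        + (-(c : ℂ) / 2) • pauliString N i j pauliX pauliX
        + ((b : ℂ) / 2) • pauliString N i j pauliY pauliY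
        + (-(d : ℂ) / 2) • pauliString N i j pauliX pauliY
        + ((a : ℂ) / 2) • pauliString N i j pauliY pauliX := by
  intro v M
  simp only [v, M, majorana_even, majorana_odd, Fin.sum_univ_four]
  simp [jwStr_mul_self, jwStr_mul_lt N i j hij, jwStr_mul_gt N i j hij, -neg_smul,
    pXY, pYX, pXZ, pZX, pYZ, pZY, singleSite_smul, pauliString_smul]
  match_scalars <;> ring_nf <;> simp <;> ring
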